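/- arXiv:2408.02613 — 2 statements merged into one kernel-verified Lean document; each statement's English description precedes it below -/
import Mathlib

section
/- Let p > 0 and let F : ℝ² → ℂ be integrable and p-radial, i.e. there exists a function φ on [0,∞) such that F(x) = φ(|x|_p) for all x ∈ ℝ². Then the Fourier transform of F satisfies F̂(ξ) = p · Γ(1/p)² · ∫₀^∞ J₀^[p](2π r ξ) φ(r) r dr for every ξ ∈ ℝ². -/
open Real MeasureTheory

/-- The `p`-norm of a point of `ℝ²`. -/
noncomputable def pnorm (p : ℝ) (x : ℝ × ℝ) : ℝ := (|x.1| ^ p + |x.2| ^ p) ^ (1 / p)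

/-- The generalized Bessel function of order zero `J₀^[p]`. -/
noncomputable def Jzero (p : ℝ) (η : ℝ × ℝ) : ℝ :=
  (1 / Real.Gamma (1 / p) ^ 2) * (2 / p) ^ 2 *
    ∫ t in (0:ℝ)..1,
      Real.cos (η.1 * t ^ (1 / p)) * Real.cos (η.2 * (1 - t) ^ (1 / p)) *
        t ^ (1 / p - 1) * (1 - t) ^ (1 / p - 1)

/-- The generalized Bessel function of positive order `J_ω^[p]`. -/
noncomputable def Jord (p ω : ℝ) (η : ℝ × ℝ) : ℝ :=
  pnorm p η ^ ω / (p ^ (ω - 1) * Real.Gamma ω) *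
    ∫ τ in (0:ℝ)..1, Jzero p (τ * η.1, τ * η.2) * τ * (1 - τ ^ p) ^ (ω - 1)

/-- `e^{2πiθ}`. -/
noncomputable def e2πi (θ : ℝ) : ℂ := Complex.exp (((2 * Real.pi * θ : ℝ) : ℂ) * Complex.I)

/-- The integral version `𝒟_β^[p](s : x)`. -/
noncomputable def Dcal (p β s : ℝ) (x : ℝ × ℝ) : ℂ :=
  ((1 / Real.Gamma (β + 1) : ℝ) : ℂ) *
    ∫ ξ in {ξ : ℝ × ℝ | pnorm p ξ ^ p < s},
      (((s - pnorm p ξ ^ p) ^ β : ℝ) : ℂ) * e2πi (x.1 * ξ.1 + x.2 * ξ.2)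

/-- The lattice sum version `D_β^[p](s : x)`. -/
noncomputable def Dlat (p β s : ℝ) (x : ℝ × ℝ) : ℂ :=
  ((1 / Real.Gamma (β + 1) : ℝ) : ℂ) *
    ∑' m : ℤ × ℤ,
      if pnorm p ((m.1 : ℝ), (m.2 : ℝ)) ^ p < s then
        (((s - pnorm p ((m.1 : ℝ), (m.2 : ℝ)) ^ p) ^ β : ℝ) : ℂ) *
          e2πi (x.1 * (m.1 : ℝ) + x.2 * (m.2 : ℝ))
      else 0

/-- An integral is unchanged by averaging the integrand over a measure preserving map. -/
lemma integral_eq_integral_average {α : Type*} [MeasurableSpace α] {μ : Measure α} {σ : α → α}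
    (hσ : MeasurePreserving σ μ μ) (hσ' : MeasurableEmbedding σ) {G : α → ℂ}
    (hG : Integrable G μ) : ∫ x, G x ∂μ = ∫ x, (G x + G (σ x)) / 2 ∂μ := by
  have hG' : Integrable (fun x => G (σ x)) μ := hσ.integrable_comp_of_integrable hG
  rw [integral_div, integral_add hG hG', hσ.integral_comp hσ' G]
  ring

/-- The integral of an even function over `ℝ` is twice its integral over the half line. -/
lemma integral_even {f : ℝ → ℂ} (hf : ∀ x, f (-x) = f x) :
    ∫ x, f x = 2 * ∫ x in Set.Ioi (0 : ℝ), f x := by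
  have hIic : ∫ x in Set.Iic (0 : ℝ), f x = ∫ x in Set.Ioi (0 : ℝ), f x := by
    simpa [hf] using (integral_comp_neg_Ioi (0 : ℝ) f).symm
  by_cases h : IntegrableOn f (Set.Ioi 0)
  · have h' : IntegrableOn f (Set.Iic 0) := by
      have := (Iff.mpr integrableOn_Ici_iff_integrableOn_Ioi h).comp_neg
      simpa [hf] using this
    rw [← intervalIntegral.integral_Iic_add_Ioi h' h, hIic, two_mul]
  · rw [integral_undef h, integral_undef fun h' => h h'.integrableOn, mul_zero]

/-- The integral over the plane of a function that is even in each variable is four times its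
integral over the open first quadrant. -/
lemma integral_even_even {H : ℝ × ℝ → ℂ} (hH : Integrable H)
    (h₁ : ∀ x y, H (-x, y) = H (x, y)) (h₂ : ∀ x y, H (x, -y) = H (x, y)) :
    ∫ x, H x = 4 * ∫ x in Set.Ioi (0 : ℝ) ×ˢ Set.Ioi (0 : ℝ), H x := by
  rw [Measure.volume_eq_prod] at hH ⊢
  rw [integral_prod _ hH, setIntegral_prod _ hH.integrableOn]
  simp_rw [fun x => integral_even (f := fun y => H (x, y)) (h₂ x)]
  rw [integral_const_mul, integral_even fun x => by simp_rw [h₁]]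
  ring

/-- Polar coordinates adapted to the `p`-norm on the first quadrant, with `a = 1 / p`. -/
noncomputable def ppolar (a : ℝ) (z : ℝ × ℝ) : ℝ × ℝ := (z.1 * z.2 ^ a, z.1 * (1 - z.2) ^ a)

/-- The derivative of `ppolar`. -/
noncomputable def fderivPpolar (a : ℝ) (z : ℝ × ℝ) : ℝ × ℝ →L[ℝ] ℝ × ℝ :=
  (Matrix.toLin (.finTwoProd ℝ) (.finTwoProd ℝ)
    !![z.2 ^ a, z.1 * (a * z.2 ^ (a - 1));
      (1 - z.2) ^ a, -(z.1 * (a * (1 - z.2) ^ (a - 1)))]).toContinuousLinearMap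

lemma hasFDerivAt_ppolar (a : ℝ) {z : ℝ × ℝ} (h₀ : 0 < z.2) (h₁ : z.2 < 1) :
    HasFDerivAt (ppolar a) (fderivPpolar a z) z := by
  unfold fderivPpolar
  rw [Matrix.toLin_finTwoProd_toContinuousLinearMap]
  have d₁ : HasDerivAt (fun t : ℝ => t ^ a) (a * z.2 ^ (a - 1)) z.2 :=
    Real.hasDerivAt_rpow_const (Or.inl h₀.ne')
  have d₂ : HasDerivAt (fun t : ℝ => (1 - t) ^ a) (-(a * (1 - z.2) ^ (a - 1))) z.2 := by
    exact (((hasDerivAt_id z.2).const_sub 1).rpow_const (p := a)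
      (Or.inl (sub_pos.2 h₁).ne')).congr_deriv (by simp)
  convert! HasFDerivAt.prodMk (𝕜 := ℝ)
    (hasFDerivAt_fst.mul (d₁.comp_hasFDerivAt z hasFDerivAt_snd))
    (hasFDerivAt_fst.mul (d₂.comp_hasFDerivAt z hasFDerivAt_snd)) using 2 <;>
  simp [smul_smul, add_comm, smul_neg, neg_smul _ (ContinuousLinearMap.snd ℝ ℝ ℝ)]

lemma abs_det_fderivPpolar {a : ℝ} (ha : 0 < a) {z : ℝ × ℝ} (hr : 0 < z.1) (h₀ : 0 < z.2)
    (h₁ : z.2 < 1) :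
    |(fderivPpolar a z).det| = z.1 * (a * (z.2 ^ (a - 1) * (1 - z.2) ^ (a - 1))) := by
  have h₁' : 0 < 1 - z.2 := sub_pos.2 h₁
  have e₁ : z.2 ^ a = z.2 ^ (a - 1) * z.2 := by
    rw [← Real.rpow_add_one h₀.ne', sub_add_cancel]
  have e₂ : (1 - z.2) ^ a = (1 - z.2) ^ (a - 1) * (1 - z.2) := by
    rw [← Real.rpow_add_one h₁'.ne', sub_add_cancel]
  have hdet : (fderivPpolar a z).det =
      -(z.1 * (a * (z.2 ^ (a - 1) * (1 - z.2) ^ (a - 1)))) := by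
    unfold fderivPpolar
    simp only [LinearMap.det_toContinuousLinearMap, LinearMap.det_toLin, Matrix.det_fin_two_of]
    rw [e₁, e₂]
    ring
  rw [hdet, abs_neg, abs_of_nonneg (by positivity)]

lemma pnorm_ppolar {p : ℝ} (hp : 0 < p) {z : ℝ × ℝ} (hr : 0 < z.1) (h₀ : 0 < z.2)
    (h₁ : z.2 < 1) : pnorm p (ppolar (1 / p) z) = z.1 := by
  have h₁' : 0 < 1 - z.2 := sub_pos.2 h₁
  unfold pnorm ppolar
  rw [abs_of_pos (by positivity), abs_of_pos (by positivity),
    Real.mul_rpow hr.le (by positivity), Real.mul_rpow hr.le (by positivity),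
    ← Real.rpow_mul h₀.le, ← Real.rpow_mul h₁'.le, one_div_mul_cancel hp.ne', Real.rpow_one,
    Real.rpow_one, ← mul_add, add_sub_cancel, mul_one, ← Real.rpow_mul hr.le,
    mul_one_div_cancel hp.ne', Real.rpow_one]

lemma injOn_ppolar {p : ℝ} (hp : 0 < p) :
    Set.InjOn (ppolar (1 / p)) (Set.Ioi 0 ×ˢ Set.Ioo 0 1) := by
  rintro z ⟨hr, h₀, h₁⟩ w ⟨hr', h₀', h₁'⟩ h
  have hzw : z.1 = w.1 := by
    rw [← pnorm_ppolar hp hr h₀ h₁, h, pnorm_ppolar hp hr' h₀' h₁']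
  refine Prod.ext hzw ?_
  have h' : z.1 * z.2 ^ (1 / p) = w.1 * w.2 ^ (1 / p) := congrArg Prod.fst h
  rw [hzw] at h'
  exact (Real.rpow_left_inj h₀.le h₀'.le (one_div_pos.2 hp).ne').1 (mul_left_cancel₀ hr'.ne' h')

lemma image_ppolar {p : ℝ} (hp : 0 < p) :
    ppolar (1 / p) '' (Set.Ioi 0 ×ˢ Set.Ioo 0 1) = Set.Ioi 0 ×ˢ Set.Ioi 0 := by
  ext ⟨x, y⟩
  constructor
  · rintro ⟨z, ⟨hr, h₀, h₁⟩, h⟩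
    have hr' : 0 < z.1 := hr
    have h₁' : 0 < 1 - z.2 := sub_pos.2 h₁
    rw [← h]
    exact ⟨mul_pos hr' (Real.rpow_pos_of_pos h₀ _), mul_pos hr' (Real.rpow_pos_of_pos h₁' _)⟩
  · rintro ⟨hx, hy⟩
    replace hx : 0 < x := hx
    replace hy : 0 < y := hy
    have hs : 0 < x ^ p + y ^ p := by positivity
    have key : ∀ {u : ℝ}, 0 < u →
        (x ^ p + y ^ p) ^ (1 / p) * (u ^ p / (x ^ p + y ^ p)) ^ (1 / p) = u := by
      intro u hu
      rw [← Real.mul_rpow hs.le (by positivity), mul_div_cancel₀ _ hs.ne',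
        ← Real.rpow_mul hu.le, mul_one_div_cancel hp.ne', Real.rpow_one]
    refine ⟨((x ^ p + y ^ p) ^ (1 / p), x ^ p / (x ^ p + y ^ p)),
      ⟨Real.rpow_pos_of_pos hs _, by positivity, ?_⟩, ?_⟩
    · rw [div_lt_one hs]
      exact lt_add_of_pos_right _ (by positivity)
    · have : 1 - x ^ p / (x ^ p + y ^ p) = y ^ p / (x ^ p + y ^ p) := by
        field_simp
        ring
      simp only [ppolar, this, key hx, key hy]

/-- Integration over the first quadrant in polar coordinates adapted to the `p`-norm. -/
lemma integral_quadrant_eq {p : ℝ} (hp : 0 < p) {H : ℝ × ℝ → ℂ} (hH : Integrable H) :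
    ∫ x in Set.Ioi (0 : ℝ) ×ˢ Set.Ioi (0 : ℝ), H x =
      ∫ r in Set.Ioi (0 : ℝ), ∫ t in Set.Ioo (0 : ℝ) 1,
        ((r * (1 / p * (t ^ (1 / p - 1) * (1 - t) ^ (1 / p - 1))) : ℝ) : ℂ) *
          H (ppolar (1 / p) (r, t)) := by
  have hS : MeasurableSet (Set.Ioi (0 : ℝ) ×ˢ Set.Ioo (0 : ℝ) 1) :=
    measurableSet_Ioi.prod measurableSet_Ioo
  have hd : ∀ z ∈ Set.Ioi (0 : ℝ) ×ˢ Set.Ioo (0 : ℝ) 1,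
      HasFDerivWithinAt (ppolar (1 / p)) (fderivPpolar (1 / p) z)
        (Set.Ioi (0 : ℝ) ×ˢ Set.Ioo (0 : ℝ) 1) z :=
    fun z hz => (hasFDerivAt_ppolar _ hz.2.1 hz.2.2).hasFDerivWithinAt
  have heq : Set.EqOn (fun z => |(fderivPpolar (1 / p) z).det| • H (ppolar (1 / p) z))
      (fun z => ((z.1 * (1 / p * (z.2 ^ (1 / p - 1) * (1 - z.2) ^ (1 / p - 1))) : ℝ) : ℂ) *
          H (ppolar (1 / p) z)) (Set.Ioi (0 : ℝ) ×ˢ Set.Ioo (0 : ℝ) 1) := by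
    rintro z ⟨hr, h₀, h₁⟩
    simp only [abs_det_fderivPpolar (one_div_pos.2 hp) hr h₀ h₁, Complex.real_smul]
  have hJ := (integrableOn_image_iff_integrableOn_abs_det_fderiv_smul volume hS hd
    (injOn_ppolar hp) H).1 hH.integrableOn
  rw [← image_ppolar hp, integral_image_eq_integral_abs_det_fderiv_smul volume hS hd
    (injOn_ppolar hp) H, setIntegral_congr_fun hS heq]
  exact setIntegral_prod _ (hJ.congr_fun heq hS)

lemma e2πi_add (a b : ℝ) : e2πi (a + b) = e2πi a * e2πi b := by
  unfold e2πi
  rw [← Complex.exp_add]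
  push_cast
  ring_nf

lemma e2πi_add_e2πi_neg (a : ℝ) : (e2πi a + e2πi (-a)) / 2 = (Real.cos (2 * π * a) : ℂ) := by
  unfold e2πi
  rw [Complex.ofReal_cos, Complex.cos]
  push_cast
  ring_nf

lemma norm_e2πi (a : ℝ) : ‖e2πi a‖ = 1 := Complex.norm_exp_ofReal_mul_I _

lemma continuous_e2πi : Continuous e2πi := by
  unfold e2πi
  fun_prop

/-- The Fourier integral of a function that is even in each variable is a cosine integral. -/
lemma integral_mul_e2πi_even {F : ℝ × ℝ → ℂ} (hF : Integrable F)
    (h₁ : ∀ x y, F (-x, y) = F (x, y)) (h₂ : ∀ x y, F (x, -y) = F (x, y)) (ξ : ℝ × ℝ) :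
    ∫ x : ℝ × ℝ, F x * e2πi (-(ξ.1 * x.1 + ξ.2 * x.2)) =
      ∫ x : ℝ × ℝ, F x *
        ((Real.cos (2 * π * (ξ.1 * x.1)) * Real.cos (2 * π * (ξ.2 * x.2)) : ℝ) : ℂ) := by
  have hneg : MeasurePreserving (fun x : ℝ => -x) volume volume :=
    Measure.measurePreserving_neg volume
  have hm₁ : MeasurePreserving (Prod.map (fun x : ℝ => -x) (id : ℝ → ℝ)) volume volume :=
    hneg.prod (.id volume)
  have hm₂ : MeasurePreserving (Prod.map (id : ℝ → ℝ) (fun x : ℝ => -x)) volume volume :=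
    (MeasurePreserving.id volume).prod hneg
  have he₁ : MeasurableEmbedding (Prod.map (fun x : ℝ => -x) (id : ℝ → ℝ)) :=
    (Homeomorph.neg ℝ).measurableEmbedding.prodMap .id
  have he₂ : MeasurableEmbedding (Prod.map (id : ℝ → ℝ) (fun x : ℝ => -x)) :=
    MeasurableEmbedding.id.prodMap (Homeomorph.neg ℝ).measurableEmbedding
  have hG : Integrable fun x : ℝ × ℝ => F x * e2πi (-(ξ.1 * x.1 + ξ.2 * x.2)) := by
    refine hF.mul_bdd (c := 1) ?_ (.of_forall fun x => (norm_e2πi _).le)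
    exact (continuous_e2πi.comp (by fun_prop)).aestronglyMeasurable
  have hG' : Integrable fun x : ℝ × ℝ =>
      F x * ((Real.cos (2 * π * (ξ.1 * x.1)) : ℝ) : ℂ) * e2πi (-(ξ.2 * x.2)) := by
    refine (hF.mul_bdd (c := 1) ?_ (.of_forall fun x => ?_)).mul_bdd (c := 1) ?_
      (.of_forall fun x => (norm_e2πi _).le)
    · exact (by fun_prop : Continuous _).aestronglyMeasurable
    · rw [Complex.norm_real]
      exact Real.abs_cos_le_one _
    · exact (continuous_e2πi.comp (by fun_prop)).aestronglyMeasurable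
  rw [integral_eq_integral_average hm₁ he₁ hG]
  calc
    _ = ∫ x : ℝ × ℝ, F x * ((Real.cos (2 * π * (ξ.1 * x.1)) : ℝ) : ℂ) * e2πi (-(ξ.2 * x.2)) := by
      congr 1
      ext ⟨x, y⟩
      simp only [Prod.map, id, h₁, neg_add, e2πi_add, mul_neg, neg_neg, ← e2πi_add_e2πi_neg]
      ring
    _ = _ := by
      rw [integral_eq_integral_average hm₂ he₂ hG']
      congr 1
      ext ⟨x, y⟩
      simp only [Prod.map, id, h₂, mul_neg, neg_neg, Complex.ofReal_mul, ← e2πi_add_e2πi_neg]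
      ring

/-- The Fourier transform of an integrable `p`-radial function on `ℝ²` is given by an
integral against the generalized Bessel function `J₀^[p]` (generalized Hankel transform). -/
theorem fourier_p_radial (p : ℝ) (hp : 0 < p) (F : ℝ × ℝ → ℂ)
    (hF : Integrable F) (φ : ℝ → ℂ) (hrad : ∀ x : ℝ × ℝ, F x = φ (pnorm p x)) :
    ∀ ξ : ℝ × ℝ,
      (∫ x : ℝ × ℝ, F x * e2πi (-(ξ.1 * x.1 + ξ.2 * x.2))) =
        ((p * Real.Gamma (1 / p) ^ 2 : ℝ) : ℂ) *
          ∫ r in Set.Ioi (0 : ℝ),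
            ((Jzero p (2 * Real.pi * r * ξ.1, 2 * Real.pi * r * ξ.2) : ℝ) : ℂ) * φ r * (r : ℂ) := by
  intro ξ
  have h₁ : ∀ x y, F (-x, y) = F (x, y) := fun x y => by simp [hrad, pnorm]
  have h₂ : ∀ x y, F (x, -y) = F (x, y) := fun x y => by simp [hrad, pnorm]
  rw [integral_mul_e2πi_even hF h₁ h₂]
  have hH : Integrable fun x : ℝ × ℝ => F x *
      ((Real.cos (2 * π * (ξ.1 * x.1)) * Real.cos (2 * π * (ξ.2 * x.2)) : ℝ) : ℂ) := by
    refine hF.mul_bdd (c := 1) (by fun_prop : Continuous _).aestronglyMeasurable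
      (.of_forall fun x => ?_)
    rw [Complex.norm_real, norm_mul]
    exact mul_le_one₀ (Real.abs_cos_le_one _) (norm_nonneg _) (Real.abs_cos_le_one _)
  rw [integral_even_even hH (fun x y => by simp [h₁]) (fun x y => by simp [h₂]),
    integral_quadrant_eq hp hH, ← integral_const_mul, ← integral_const_mul]
  refine setIntegral_congr_fun measurableSet_Ioi fun r hr => ?_
  have hΓ : Real.Gamma (1 / p) ≠ 0 := (Real.Gamma_pos_of_pos (one_div_pos.2 hp)).ne'
  simp only [Jzero]
  rw [intervalIntegral.integral_of_le zero_le_one, integral_Ioc_eq_integral_Ioo]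
  calc
    _ = 4 * ∫ t in Set.Ioo (0 : ℝ) 1, (1 / p * r * φ r : ℂ) *
        ((Real.cos (2 * π * r * ξ.1 * t ^ (1 / p)) *
        Real.cos (2 * π * r * ξ.2 * (1 - t) ^ (1 / p)) *
        t ^ (1 / p - 1) * (1 - t) ^ (1 / p - 1) : ℝ) : ℂ) := by
      congr 1
      refine setIntegral_congr_fun measurableSet_Ioo fun t ht => ?_
      simp only [hrad, pnorm_ppolar hp (z := (r, t)) hr ht.1 ht.2]
      simp only [ppolar]
      rw [show 2 * π * (ξ.1 * (r * t ^ (1 / p))) = 2 * π * r * ξ.1 * t ^ (1 / p) by ring,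
        show 2 * π * (ξ.2 * (r * (1 - t) ^ (1 / p))) = 2 * π * r * ξ.2 * (1 - t) ^ (1 / p) by ring]
      push_cast
      ring
    _ = _ := by
      rw [integral_const_mul, integral_complex_ofReal]
      have hp' : (p : ℂ) ≠ 0 := mod_cast hp.ne'
      have hΓ' : ((Real.Gamma (1 / p) : ℝ) : ℂ) ≠ 0 := mod_cast hΓ
      simp only [Complex.ofReal_mul, Complex.ofReal_pow, Complex.ofReal_div, Complex.ofReal_one,
        Complex.ofReal_ofNat]
      generalize ((Real.Gamma (1 / p) : ℝ) : ℂ) = g at hΓ' ⊢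
      generalize ((∫ t in Set.Ioo (0 : ℝ) 1, _ : ℝ) : ℂ) = I
      field_simp
      ring
end

section
/- Let p > 0, β > −1 and a > 0. Then the function U_{β,a}^[p] is integrable on ℝ² and its Fourier transform satisfies Û_{β,a}^[p](x) = a^(pβ+2) · p^(β+1) · Γ(β+1) · Γ(1/p)² · J_{β+1}^[p](2π a x) / (2π a |x|_p)^(β+1) for every x ∈ ℝ² with x ≠ 0. -/
open Real MeasureTheory

/-- The function `U_{β,a}^[p]`. -/
noncomputable def U (p β a : ℝ) (x : ℝ × ℝ) : ℝ :=
  if pnorm p x < a then (a ^ p - pnorm p x ^ p) ^ β else 0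

open Set

theorem pnorm_abs (p : ℝ) (y : ℝ × ℝ) : pnorm p (|y.1|, |y.2|) = pnorm p y := by
  simp [pnorm]

theorem pnorm_rpow {p : ℝ} (hp : 0 < p) (y : ℝ × ℝ) :
    pnorm p y ^ p = |y.1| ^ p + |y.2| ^ p := by
  rw [pnorm, ← rpow_mul (by positivity), one_div_mul_cancel hp.ne', rpow_one]

theorem pnorm_pos (p : ℝ) {y : ℝ × ℝ} (hy : 0 < y.1) : 0 < pnorm p y := by
  have : 0 < |y.1| := abs_pos.2 hy.ne'
  unfold pnorm
  positivity

theorem pnorm_pos_of_ne_zero (p : ℝ) {y : ℝ × ℝ} (hy : y ≠ 0) : 0 < pnorm p y := by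
  have : 0 < |y.1| ∨ 0 < |y.2| := by
    by_contra! h
    exact hy (Prod.ext (abs_nonpos_iff.1 h.1) (abs_nonpos_iff.1 h.2))
  unfold pnorm
  rcases this with h | h <;> positivity

theorem pnorm_const_mul {p c : ℝ} (hp : 0 < p) (hc : 0 ≤ c) (y : ℝ × ℝ) :
    pnorm p (c * y.1, c * y.2) = c * pnorm p y := by
  simp only [pnorm, abs_mul, abs_of_nonneg hc]
  rw [mul_rpow hc (abs_nonneg _), mul_rpow hc (abs_nonneg _), ← mul_add,
    mul_rpow (by positivity) (by positivity), ← rpow_mul hc, mul_one_div_cancel hp.ne', rpow_one]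

theorem measurable_pnorm (p : ℝ) : Measurable (pnorm p) := by
  unfold pnorm
  fun_prop

theorem measurable_U (p β a : ℝ) : Measurable (U p β a) := by
  have := measurable_pnorm p
  unfold U
  exact Measurable.ite (measurableSet_lt this measurable_const) (by fun_prop) measurable_const

theorem U_eq_of_pnorm_eq {p β a : ℝ} {y z : ℝ × ℝ} (h : pnorm p y = pnorm p z) :
    U p β a y = U p β a z := by
  simp only [U, h]

theorem map_abs_volume :
    Measure.map (fun x : ℝ => |x|) volume = (2 : ENNReal) • volume.restrict (Ioi (0 : ℝ)) := by
  ext s hs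
  rw [Measure.map_apply (by fun_prop) hs, Measure.smul_apply, Measure.restrict_apply hs,
    smul_eq_mul, two_mul]
  have hm : MeasurableSet (s ∩ Ioi 0) := hs.inter measurableSet_Ioi
  have hneg : volume (-(s ∩ Ioi 0)) = volume (s ∩ Ioi (0 : ℝ)) := Measure.measure_neg _ _
  nth_rw 1 [← hneg]
  rw [← measure_union _ hm]
  · refine measure_congr ?_
    filter_upwards [Measure.ae_ne volume (0 : ℝ)] with x hx
    apply propext
    change |x| ∈ s ↔ (-x ∈ s ∧ 0 < -x) ∨ (x ∈ s ∧ 0 < x)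
    rcases lt_or_gt_of_ne hx with h | h
    · simp [abs_of_neg h, h, h.le]
    · simp [abs_of_pos h, h, h.le]
  · rw [Set.disjoint_left]
    rintro x ⟨-, h1⟩ ⟨-, h2⟩
    simp only [mem_Ioi, Left.neg_pos_iff] at h1 h2
    exact lt_asymm h1 h2

theorem map_prod_abs_volume :
    Measure.map (fun y : ℝ × ℝ => (|y.1|, |y.2|)) volume =
      (4 : ENNReal) • volume.restrict (Ioi (0 : ℝ) ×ˢ Ioi (0 : ℝ)) := by
  have h := Measure.map_prod_map (volume : Measure ℝ) (volume : Measure ℝ)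
    (f := fun x : ℝ => |x|) (g := fun x : ℝ => |x|) (by fun_prop) (by fun_prop)
  rw [map_abs_volume, Measure.prod_smul_left, Measure.prod_smul_right, smul_smul,
    Measure.prod_restrict] at h
  rw [show (4 : ENNReal) = 2 * 2 by norm_num]
  exact h.symm

theorem integrable_comp_prod_abs_iff {H : ℝ × ℝ → ℝ} (hH : Measurable H) :
    Integrable (fun y : ℝ × ℝ => H (|y.1|, |y.2|)) ↔ IntegrableOn H (Ioi 0 ×ˢ Ioi 0) := by
  have h := integrable_map_measure (μ := volume) (f := fun y : ℝ × ℝ => (|y.1|, |y.2|)) (g := H)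
    hH.aestronglyMeasurable (by fun_prop)
  rw [map_prod_abs_volume, integrable_smul_measure (by norm_num) (by norm_num)] at h
  exact h.symm

theorem integral_comp_prod_abs {H : ℝ × ℝ → ℝ} (hH : Measurable H) :
    ∫ y : ℝ × ℝ, H (|y.1|, |y.2|) = 4 * ∫ y in Ioi 0 ×ˢ Ioi 0, H y := by
  have h := integral_map (μ := volume) (φ := fun y : ℝ × ℝ => (|y.1|, |y.2|)) (f := H)
    (by fun_prop) hH.aestronglyMeasurable
  rw [map_prod_abs_volume, integral_smul_measure] at h
  simpa using h.symm

/-- Polar coordinates adapted to the `p`-norm, normalised so that radius `1` is `|x|_p = a`. -/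
noncomputable def lpPolar (p a : ℝ) (q : ℝ × ℝ) : ℝ × ℝ :=
  (a * q.1 * q.2 ^ (1 / p), a * q.1 * (1 - q.2) ^ (1 / p))

/-- The derivative of `lpPolar`. -/
noncomputable def fderivLpPolar (p a : ℝ) (q : ℝ × ℝ) : ℝ × ℝ →L[ℝ] ℝ × ℝ :=
  (Matrix.toLin (.finTwoProd ℝ) (.finTwoProd ℝ)
    !![a * q.2 ^ (1 / p), a * q.1 * (1 / p * q.2 ^ (1 / p - 1));
      a * (1 - q.2) ^ (1 / p),
      -(a * q.1 * (1 / p * (1 - q.2) ^ (1 / p - 1)))]).toContinuousLinearMap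

theorem hasFDerivAt_lpPolar (p a : ℝ) {q : ℝ × ℝ} (h0 : 0 < q.2) (h1 : q.2 < 1) :
    HasFDerivAt (lpPolar p a) (fderivLpPolar p a q) q := by
  have d1 : HasDerivAt (fun t : ℝ => t ^ (1 / p)) (1 / p * q.2 ^ (1 / p - 1)) q.2 :=
    hasDerivAt_rpow_const (Or.inl h0.ne')
  have d2 : HasDerivAt (fun t : ℝ => (1 - t) ^ (1 / p)) (-(1 / p * (1 - q.2) ^ (1 / p - 1)))
      q.2 := by
    have := ((hasDerivAt_id q.2).const_sub 1).rpow_const (p := 1 / p) (Or.inl (sub_pos.2 h1).ne')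
    convert! this using 1
    simp
  unfold fderivLpPolar
  rw [Matrix.toLin_finTwoProd_toContinuousLinearMap]
  have hr : HasFDerivAt (fun q : ℝ × ℝ => a * q.1) (a • ContinuousLinearMap.fst ℝ ℝ ℝ) q :=
    hasFDerivAt_fst.const_mul a
  convert!
    HasFDerivAt.prodMk (𝕜 := ℝ)
      (hr.mul (d1.comp_hasFDerivAt q hasFDerivAt_snd))
      (hr.mul (d2.comp_hasFDerivAt q hasFDerivAt_snd)) using 2 <;>
  · ext <;> simp [mul_comm, mul_left_comm]

theorem abs_det_fderivLpPolar {p a : ℝ} (hp : 0 < p) {q : ℝ × ℝ} (hq : 0 < q.1) (h0 : 0 < q.2)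
    (h1 : q.2 < 1) :
    |(fderivLpPolar p a q).det| =
      a ^ 2 / p * (q.1 * (q.2 ^ (1 / p - 1) * (1 - q.2) ^ (1 / p - 1))) := by
  have h1' : 0 < 1 - q.2 := sub_pos.2 h1
  have e1 : q.2 ^ (1 / p) = q.2 * q.2 ^ (1 / p - 1) := by
    rw [rpow_sub_one h0.ne']; field_simp
  have e2 : (1 - q.2) ^ (1 / p) = (1 - q.2) * (1 - q.2) ^ (1 / p - 1) := by
    rw [rpow_sub_one h1'.ne']; field_simp
  unfold fderivLpPolar
  rw [LinearMap.det_toContinuousLinearMap, LinearMap.det_toLin, Matrix.det_fin_two_of]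
  rw [e1, e2, ← abs_neg, ← abs_of_nonneg (a := a ^ 2 / p * _) (by positivity)]
  congr 1
  ring

theorem pnorm_lpPolar {p a : ℝ} (hp : 0 < p) (ha : 0 < a) {q : ℝ × ℝ} (hq : 0 < q.1)
    (h0 : 0 < q.2) (h1 : q.2 < 1) : pnorm p (lpPolar p a q) = a * q.1 := by
  have h1' : 0 < 1 - q.2 := sub_pos.2 h1
  rw [lpPolar, pnorm_const_mul hp (by positivity) (q.2 ^ (1 / p), (1 - q.2) ^ (1 / p)), pnorm]
  simp only [abs_of_pos (rpow_pos_of_pos h0 _), abs_of_pos (rpow_pos_of_pos h1' _)]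
  rw [← rpow_mul h0.le, ← rpow_mul h1'.le, one_div_mul_cancel hp.ne']
  simp

theorem injOn_lpPolar {p a : ℝ} (hp : 0 < p) (ha : 0 < a) :
    InjOn (lpPolar p a) (Ioo 0 1 ×ˢ Ioo 0 1) := by
  rintro ⟨r, t⟩ ⟨hr, ht⟩ ⟨s, u⟩ ⟨hs, hu⟩ h
  simp only at hr ht hs hu
  have hrs : r = s := by
    have := congrArg (pnorm p) h
    rw [pnorm_lpPolar hp ha hr.1 ht.1 ht.2, pnorm_lpPolar hp ha hs.1 hu.1 hu.2] at this
    exact mul_left_cancel₀ ha.ne' this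
  subst hrs
  have h1 : a * r * t ^ (1 / p) = a * r * u ^ (1 / p) := congrArg Prod.fst h
  have h2 := mul_left_cancel₀ (mul_pos ha hr.1).ne' h1
  rw [(rpow_left_injOn (one_div_pos.2 hp).ne') ht.1.le hu.1.le h2]

theorem image_lpPolar {p a : ℝ} (hp : 0 < p) (ha : 0 < a) :
    lpPolar p a '' (Ioo 0 1 ×ˢ Ioo 0 1) = (Ioi 0 ×ˢ Ioi 0) ∩ {y | pnorm p y < a} := by
  ext y
  constructor
  · rintro ⟨⟨r, t⟩, ⟨hr, ht⟩, rfl⟩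
    simp only at hr ht
    have h1 : 0 < 1 - t := sub_pos.2 ht.2
    have hr0 := hr.1
    have ht0 := ht.1
    refine ⟨⟨?_, ?_⟩, ?_⟩
    · simp only [lpPolar, mem_Ioi]; positivity
    · simp only [lpPolar, mem_Ioi]; positivity
    · rw [mem_ofPred_eq, pnorm_lpPolar hp ha hr.1 ht.1 ht.2]
      nlinarith [hr.2]
  · rintro ⟨⟨h1, h2⟩, h3⟩
    simp only [mem_Ioi, mem_ofPred_eq] at h1 h2 h3
    have hN := pnorm_pos p h1
    have hs := pnorm_rpow hp y
    rw [abs_of_pos h1, abs_of_pos h2] at hs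
    have hNp := rpow_pos_of_pos hN p
    have e1 := rpow_pos_of_pos h1 p
    have e2 := rpow_pos_of_pos h2 p
    have ht : 1 - y.1 ^ p / pnorm p y ^ p = y.2 ^ p / pnorm p y ^ p := by
      field_simp; linarith
    refine ⟨(pnorm p y / a, y.1 ^ p / pnorm p y ^ p), ⟨⟨by positivity, ?_⟩, by positivity, ?_⟩, ?_⟩
    · exact (div_lt_one ha).2 h3
    · exact (div_lt_one hNp).2 (by linarith)
    · simp only [lpPolar]
      rw [ht, ← div_rpow h1.le hN.le, ← div_rpow h2.le hN.le, ← rpow_mul (by positivity),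
        ← rpow_mul (by positivity), mul_one_div_cancel hp.ne', rpow_one, rpow_one]
      ext <;> simp only <;> field_simp

theorem U_lpPolar {p β a : ℝ} (hp : 0 < p) (ha : 0 < a) {q : ℝ × ℝ}
    (hq : q ∈ Ioo (0 : ℝ) 1 ×ˢ Ioo (0 : ℝ) 1) :
    U p β a (lpPolar p a q) = a ^ (p * β) * (1 - q.1 ^ p) ^ β := by
  obtain ⟨⟨h0, h1⟩, h2, h3⟩ := hq
  rw [U, pnorm_lpPolar hp ha h0 h2 h3, if_pos (by nlinarith), mul_rpow ha.le h0.le, rpow_mul ha.le,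
    ← mul_rpow (by positivity) (sub_nonneg.2 (rpow_le_one h0.le h1.le hp.le))]
  ring_nf

theorem integrableOn_rpow_mul_one_sub_rpow {u v : ℝ} (hu : 0 < u) (hv : 0 < v) :
    IntegrableOn (fun t : ℝ => t ^ (u - 1) * (1 - t) ^ (v - 1)) (Ioo 0 1) := by
  have h := (Complex.betaIntegral_convergent (u := u) (v := v) (by simpa) (by simpa)).norm
  rw [intervalIntegrable_iff_integrableOn_Ioo_of_le zero_le_one] at h
  refine h.congr_fun (fun t ht => ?_) measurableSet_Ioo
  have h1 : 0 < 1 - t := sub_pos.2 ht.2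
  simp only [norm_mul]
  rw [Complex.norm_cpow_eq_rpow_re_of_pos ht.1,
    show (1 : ℂ) - (t : ℂ) = ((1 - t : ℝ) : ℂ) by push_cast; rfl,
    Complex.norm_cpow_eq_rpow_re_of_pos h1]
  simp

theorem integrableOn_mul_one_sub_rpow_rpow {p β : ℝ} (hp : 0 < p) (hβ : -1 < β) :
    IntegrableOn (fun r : ℝ => r * (1 - r ^ p) ^ β) (Ioo 0 1) := by
  have h := integrableOn_rpow_mul_one_sub_rpow (u := 2 / p) (v := β + 1) (by positivity)
    (by linarith)
  rw [← integrable_indicator_iff measurableSet_Ioo] at h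
  have h' := (integrableOn_Ioi_comp_rpow_iff _ hp.ne').2 h.integrableOn
  refine IntegrableOn.congr_fun ((h'.mono_set Ioo_subset_Ioi_self).div_const p) (fun r hr => ?_)
    measurableSet_Ioo
  have hr' : r ^ p ∈ Ioo (0 : ℝ) 1 := ⟨rpow_pos_of_pos hr.1 _, rpow_lt_one hr.1.le hr.2 hp⟩
  simp only [indicator_of_mem hr', abs_of_pos hp, smul_eq_mul, add_sub_cancel_right]
  have e : r ^ (p - 1) * (r ^ p) ^ (2 / p - 1) = r := by
    rw [← rpow_mul hr.1.le, ← rpow_add hr.1, show p - 1 + p * (2 / p - 1) = 1 by field_simp; ring,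
      rpow_one]
  calc
    _ = r ^ (p - 1) * (r ^ p) ^ (2 / p - 1) * (1 - r ^ p) ^ β := by field_simp
    _ = r * (1 - r ^ p) ^ β := by rw [e]

theorem integrableOn_U_quadrant {p β a : ℝ} (hp : 0 < p) (hβ : -1 < β) (ha : 0 < a) :
    IntegrableOn (U p β a) (Ioi 0 ×ˢ Ioi 0) := by
  have hQ : MeasurableSet (Ioi (0 : ℝ) ×ˢ Ioi (0 : ℝ)) := measurableSet_Ioi.prod measurableSet_Ioi
  have hS : MeasurableSet (Ioo (0 : ℝ) 1 ×ˢ Ioo (0 : ℝ) 1) :=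
    measurableSet_Ioo.prod measurableSet_Ioo
  have key : IntegrableOn (U p β a) ((Ioi 0 ×ˢ Ioi 0) ∩ {y | pnorm p y < a}) := by
    rw [← image_lpPolar hp ha, integrableOn_image_iff_integrableOn_abs_det_fderiv_smul volume hS
      (fun q hq => (hasFDerivAt_lpPolar p a hq.2.1 hq.2.2).hasFDerivWithinAt)
      (injOn_lpPolar hp ha)]
    have h := ((integrableOn_mul_one_sub_rpow_rpow hp hβ).mul_prod
      (integrableOn_rpow_mul_one_sub_rpow (one_div_pos.2 hp) (one_div_pos.2 hp))).const_mul
        (a ^ 2 / p * a ^ (p * β))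
    rw [Measure.prod_restrict, ← Measure.volume_eq_prod] at h
    refine IntegrableOn.congr_fun h (fun q hq => ?_) hS
    rw [abs_det_fderivLpPolar hp hq.1.1 hq.2.1 hq.2.2, U_lpPolar hp ha hq, smul_eq_mul]
    ring
  refine key.of_forall_sdiff_eq_zero hQ fun y hy => ?_
  rw [U, if_neg fun h : pnorm p y < a => hy.2 ⟨hy.1, h⟩]

theorem integrable_U {p β a : ℝ} (hp : 0 < p) (hβ : -1 < β) (ha : 0 < a) :
    Integrable (U p β a) := by
  have h := (integrable_comp_prod_abs_iff (measurable_U p β a)).2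
    (integrableOn_U_quadrant hp hβ ha)
  simpa only [U_eq_of_pnorm_eq (pnorm_abs p _)] using h

/-- The integral of `U` against a product of cosines, in terms of `Jzero`. -/
theorem integral_U_mul_cos_mul_cos {p β a : ℝ} (hp : 0 < p) (hβ : -1 < β) (ha : 0 < a)
    (b c : ℝ) :
    ∫ y : ℝ × ℝ, U p β a y * (cos (b * y.1) * cos (c * y.2)) =
      a ^ (p * β + 2) * p * Gamma (1 / p) ^ 2 *
        ∫ r in (0 : ℝ)..1, Jzero p (r * (a * b), r * (a * c)) * r * (1 - r ^ p) ^ β := by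
  have hQ : MeasurableSet (Ioi (0 : ℝ) ×ˢ Ioi (0 : ℝ)) := measurableSet_Ioi.prod measurableSet_Ioi
  have hS : MeasurableSet (Ioo (0 : ℝ) 1 ×ˢ Ioo (0 : ℝ) 1) :=
    measurableSet_Ioo.prod measurableSet_Ioo
  have hHm : Measurable fun y : ℝ × ℝ => U p β a y * (cos (b * y.1) * cos (c * y.2)) := by
    have := measurable_U p β a
    fun_prop
  have hHint : IntegrableOn (fun y : ℝ × ℝ => U p β a y * (cos (b * y.1) * cos (c * y.2)))
      (Ioi 0 ×ˢ Ioi 0) := by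
    refine Integrable.mono (integrableOn_U_quadrant hp hβ ha) hHm.aestronglyMeasurable
      (Filter.Eventually.of_forall fun y => ?_)
    rw [norm_mul, norm_mul]
    exact mul_le_of_le_one_right (norm_nonneg _)
      (mul_le_one₀ (abs_cos_le_one _) (norm_nonneg _) (abs_cos_le_one _))
  have habs : ∀ y : ℝ × ℝ, U p β a y * (cos (b * y.1) * cos (c * y.2)) =
      U p β a (|y.1|, |y.2|) * (cos (b * |y.1|) * cos (c * |y.2|)) := fun y => by
    have hc : ∀ s t : ℝ, cos (s * |t|) = cos (s * t) := fun s t => by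
      rcases abs_choice t with h | h <;> simp [h]
    rw [U_eq_of_pnorm_eq (pnorm_abs p y), hc, hc]
  have hG : Gamma (1 / p) ≠ 0 := (Gamma_pos_of_pos (one_div_pos.2 hp)).ne'
  have hsub : ∫ y in Ioi 0 ×ˢ Ioi 0, U p β a y * (cos (b * y.1) * cos (c * y.2)) =
      ∫ q in Ioo (0 : ℝ) 1 ×ˢ Ioo (0 : ℝ) 1, |(fderivLpPolar p a q).det| •
        (U p β a (lpPolar p a q) * (cos (b * (lpPolar p a q).1) * cos (c * (lpPolar p a q).2))) := by
    rw [← integral_image_eq_integral_abs_det_fderiv_smul volume hS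
      (fun q hq => (hasFDerivAt_lpPolar p a hq.2.1 hq.2.2).hasFDerivWithinAt)
      (injOn_lpPolar hp ha) (fun y => U p β a y * (cos (b * y.1) * cos (c * y.2))),
      image_lpPolar hp ha]
    refine setIntegral_eq_of_subset_of_forall_sdiff_eq_zero hQ inter_subset_left fun y hy => ?_
    rw [U, if_neg fun h : pnorm p y < a => hy.2 ⟨hy.1, h⟩, zero_mul]
  have hint : IntegrableOn (fun q => |(fderivLpPolar p a q).det| •
        (U p β a (lpPolar p a q) * (cos (b * (lpPolar p a q).1) * cos (c * (lpPolar p a q).2))))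
      (Ioo (0 : ℝ) 1 ×ˢ Ioo (0 : ℝ) 1) := by
    rw [← integrableOn_image_iff_integrableOn_abs_det_fderiv_smul volume hS
      (fun q hq => (hasFDerivAt_lpPolar p a hq.2.1 hq.2.2).hasFDerivWithinAt)
      (injOn_lpPolar hp ha) (fun y => U p β a y * (cos (b * y.1) * cos (c * y.2))),
      image_lpPolar hp ha]
    exact hHint.mono_set inter_subset_left
  rw [integral_congr_ae (Filter.Eventually.of_forall habs), integral_comp_prod_abs hHm, hsub]
  rw [Measure.volume_eq_prod] at hint ⊢
  rw [setIntegral_prod _ hint, intervalIntegral.integral_of_le zero_le_one,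
    integral_Ioc_eq_integral_Ioo, ← integral_const_mul, ← integral_const_mul]
  refine setIntegral_congr_fun measurableSet_Ioo fun r hr => ?_
  simp only [Jzero]
  rw [intervalIntegral.integral_of_le zero_le_one, integral_Ioc_eq_integral_Ioo]
  rw [rpow_add ha, rpow_two]
  have hin : ∀ t ∈ Ioo (0 : ℝ) 1, |(fderivLpPolar p a (r, t)).det| •
      (U p β a (lpPolar p a (r, t)) *
        (cos (b * (lpPolar p a (r, t)).1) * cos (c * (lpPolar p a (r, t)).2))) =
      (a ^ 2 / p * a ^ (p * β) * r * (1 - r ^ p) ^ β) *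
        (cos (r * (a * b) * t ^ (1 / p)) * cos (r * (a * c) * (1 - t) ^ (1 / p)) *
          t ^ (1 / p - 1) * (1 - t) ^ (1 / p - 1)) := fun t ht => by
    rw [abs_det_fderivLpPolar hp hr.1 ht.1 ht.2, U_lpPolar hp ha ⟨hr, ht⟩, smul_eq_mul]
    simp only [lpPolar]
    rw [show b * (a * r * t ^ (1 / p)) = r * (a * b) * t ^ (1 / p) by ring,
      show c * (a * r * (1 - t) ^ (1 / p)) = r * (a * c) * (1 - t) ^ (1 / p) by ring]
    ring
  rw [setIntegral_congr_fun measurableSet_Ioo hin, integral_const_mul]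
  field_simp
  ring

/-- Even functions are integrated against `e2πi` by integrating against cosines. -/
theorem integral_mul_e2πi_of_even {f : ℝ × ℝ → ℝ} (hf : Integrable f)
    (h1 : ∀ y : ℝ × ℝ, f (-y.1, y.2) = f y) (h2 : ∀ y : ℝ × ℝ, f (y.1, -y.2) = f y)
    (x : ℝ × ℝ) :
    ∫ y : ℝ × ℝ, (f y : ℂ) * e2πi (-(x.1 * y.1 + x.2 * y.2)) =
      ((∫ y : ℝ × ℝ, f y * (cos (2 * π * x.1 * y.1) * cos (2 * π * x.2 * y.2)) : ℝ) : ℂ) := by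
  have hmul : ∀ g : ℝ × ℝ → ℝ, Continuous g → (∀ y, |g y| ≤ 1) →
      Integrable fun y => f y * g y := fun g hg hb =>
    hf.mul_bdd (c := 1) hg.aestronglyMeasurable (Filter.Eventually.of_forall hb)
  have hcos := hmul (fun y => cos (2 * π * (x.1 * y.1 + x.2 * y.2))) (by fun_prop)
    fun y => abs_cos_le_one _
  have hsin := hmul (fun y => sin (2 * π * (x.1 * y.1 + x.2 * y.2))) (by fun_prop)
    fun y => abs_sin_le_one _
  have hcc := hmul (fun y => cos (2 * π * x.1 * y.1) * cos (2 * π * x.2 * y.2)) (by fun_prop)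
    fun y => by
      rw [abs_mul]; exact mul_le_one₀ (abs_cos_le_one _) (abs_nonneg _) (abs_cos_le_one _)
  have hss := hmul (fun y => sin (2 * π * x.1 * y.1) * sin (2 * π * x.2 * y.2)) (by fun_prop)
    fun y => by
      rw [abs_mul]; exact mul_le_one₀ (abs_sin_le_one _) (abs_nonneg _) (abs_sin_le_one _)
  have hneg : ∀ y : ℝ × ℝ, f (-y) = f y := fun y => by
    rw [← h2 y, ← h1 (y.1, -y.2)]; rfl
  have hsin0 : ∫ y : ℝ × ℝ, f y * sin (2 * π * (x.1 * y.1 + x.2 * y.2)) = 0 := by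
    have h := integral_neg_eq_self (μ := (volume : Measure (ℝ × ℝ)))
      (fun y : ℝ × ℝ => f y * sin (2 * π * (x.1 * y.1 + x.2 * y.2)))
    have h' : ∀ y : ℝ × ℝ, f (-y) * sin (2 * π * (x.1 * (-y).1 + x.2 * (-y).2)) =
        -(f y * sin (2 * π * (x.1 * y.1 + x.2 * y.2))) := fun y => by
      rw [hneg, ← mul_neg, ← sin_neg]; simp only [Prod.fst_neg, Prod.snd_neg]; ring_nf
    rw [integral_congr_ae (Filter.Eventually.of_forall h'), integral_neg] at h
    linarith
  have hss0 : ∫ y : ℝ × ℝ, f y * (sin (2 * π * x.1 * y.1) * sin (2 * π * x.2 * y.2)) = 0 := by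
    have hmp : MeasurePreserving
        ((MeasurableEquiv.refl ℝ).prodCongr (MeasurableEquiv.neg ℝ)) volume volume :=
      (MeasurePreserving.id volume).prod (Measure.measurePreserving_neg volume)
    have h := hmp.integral_comp'
      (fun y : ℝ × ℝ => f y * (sin (2 * π * x.1 * y.1) * sin (2 * π * x.2 * y.2)))
    have h' : ∀ y : ℝ × ℝ, f (y.1, -y.2) * (sin (2 * π * x.1 * y.1) * sin (2 * π * x.2 * -y.2)) =
        -(f y * (sin (2 * π * x.1 * y.1) * sin (2 * π * x.2 * y.2))) := fun y => by
      rw [h2, mul_neg (2 * π * x.2), sin_neg]; ring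
    have h'' := (integral_congr_ae (Filter.Eventually.of_forall h')).symm.trans h
    rw [integral_neg] at h''
    linarith
  have hre : ∫ y : ℝ × ℝ, f y * cos (2 * π * (x.1 * y.1 + x.2 * y.2)) =
      ∫ y : ℝ × ℝ, f y * (cos (2 * π * x.1 * y.1) * cos (2 * π * x.2 * y.2)) := by
    rw [← sub_zero (∫ y : ℝ × ℝ, f y * (cos (2 * π * x.1 * y.1) * cos (2 * π * x.2 * y.2))),
      ← hss0, ← integral_sub hcc hss]
    refine integral_congr_ae (Filter.Eventually.of_forall fun y => ?_)
    simp only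
    rw [mul_add, cos_add, ← mul_assoc, ← mul_assoc]
    ring
  have hexp : ∀ y : ℝ × ℝ, (f y : ℂ) * e2πi (-(x.1 * y.1 + x.2 * y.2)) =
      ((f y * cos (2 * π * (x.1 * y.1 + x.2 * y.2)) : ℝ) : ℂ) -
        ((f y * sin (2 * π * (x.1 * y.1 + x.2 * y.2)) : ℝ) : ℂ) * Complex.I := fun y => by
    rw [e2πi, Complex.exp_mul_I, ← Complex.ofReal_cos, ← Complex.ofReal_sin, mul_neg, cos_neg,
      sin_neg]
    push_cast
    ring
  rw [integral_congr_ae (Filter.Eventually.of_forall hexp),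
    integral_sub hcos.ofReal (hsin.ofReal.mul_const _), integral_mul_const, integral_complex_ofReal,
    integral_complex_ofReal, hsin0, hre]
  simp

/-- `U_{β,a}^[p]` is integrable and its Fourier transform is expressed by `J_{β+1}^[p]`. -/
theorem fourier_U (p β a : ℝ) (hp : 0 < p) (hβ : -1 < β) (ha : 0 < a) :
    Integrable (fun x : ℝ × ℝ => U p β a x) ∧
      ∀ x : ℝ × ℝ, x ≠ 0 →
        (∫ y : ℝ × ℝ, ((U p β a y : ℝ) : ℂ) * e2πi (-(x.1 * y.1 + x.2 * y.2))) =
          ((a ^ (p * β + 2) * p ^ (β + 1) * Real.Gamma (β + 1) * Real.Gamma (1 / p) ^ 2 *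
            (Jord p (β + 1) (2 * Real.pi * a * x.1, 2 * Real.pi * a * x.2) /
              (2 * Real.pi * a * pnorm p x) ^ (β + 1)) : ℝ) : ℂ) := by
  refine ⟨integrable_U hp hβ ha, fun x hx => ?_⟩
  rw [integral_mul_e2πi_of_even (integrable_U hp hβ ha)
      (fun y => U_eq_of_pnorm_eq (by simp [pnorm])) (fun y => U_eq_of_pnorm_eq (by simp [pnorm])),
    integral_U_mul_cos_mul_cos hp hβ ha, Jord]
  have hN := pnorm_pos_of_ne_zero p hx
  have hG : Gamma (β + 1) ≠ 0 := (Gamma_pos_of_pos (by linarith)).ne'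
  have hc : 0 < 2 * π * a := by positivity
  have hP : (2 * π * a * pnorm p x) ^ (β + 1) ≠ 0 := by positivity
  have hpβ : p ^ β ≠ 0 := by positivity
  rw [pnorm_const_mul hp hc.le x, add_sub_cancel_right, rpow_add hp, rpow_one]
  congr 1
  simp only [show a * (2 * π * x.1) = 2 * π * a * x.1 by ring,
    show a * (2 * π * x.2) = 2 * π * a * x.2 by ring]
  generalize (∫ r in (0 : ℝ)..1, Jzero p (r * (2 * π * a * x.1), r * (2 * π * a * x.2)) * r *
    (1 - r ^ p) ^ β) = I
  field_simp
end
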